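/- arXiv:2003.06004 — 2 statements merged into one kernel-verified Lean document; each statement's English description precedes it below -/
import Mathlib

section
/- Let G be a finite group, ρ a finite-dimensional representation of G over the rational numbers ℚ, and K a field extension of ℚ. If the base-changed representation K ⊗_ℚ ρ of G over K is homogeneous, then ρ is homogeneous. -/
open scoped TensorProduct

noncomputable section

/-- A submodule is invariant under a representation. -/
def RepInvariant {k G V : Type*} [Field k] [Group G] [AddCommGroup V] [Module k V]
    (ρ : Representation k G V) (p : Submodule k V) : Prop :=
  ∀ g : G, ∀ v ∈ p, ρ g v ∈ p

/-- The subrepresentation of a representation on an invariant submodule. -/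
def RepRestrict {k G V : Type*} [Field k] [Group G] [AddCommGroup V] [Module k V]
    (ρ : Representation k G V) (p : Submodule k V) (hp : RepInvariant ρ p) :
    Representation k G p where
  toFun g := (ρ g).restrict (hp g)
  map_one' := by ext v; simp [LinearMap.restrict_apply]
  map_mul' g h := by ext v; simp [LinearMap.restrict_apply]

/-- Two representations are equivalent (isomorphic) if there is an equivariant linear
equivalence between their underlying spaces. -/
def RepIso {k G V W : Type*} [Field k] [Group G] [AddCommGroup V] [Module k V]
    [AddCommGroup W] [Module k W]
    (ρ : Representation k G V) (σ : Representation k G W) : Prop :=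
  ∃ e : V ≃ₗ[k] W, ∀ (g : G) (v : V), e (ρ g v) = σ g (e v)

/-- A representation is irreducible (simple) if the space is nonzero and the only invariant
submodules are `⊥` and `⊤`. -/
def RepIrreducible {k G V : Type*} [Field k] [Group G] [AddCommGroup V] [Module k V]
    (ρ : Representation k G V) : Prop :=
  Nontrivial V ∧ ∀ p : Submodule k V, RepInvariant ρ p → p = ⊥ ∨ p = ⊤

/-- A representation is homogeneous if all of its irreducible subrepresentations are
pairwise equivalent. -/
def RepHomogeneous {k G V : Type*} [Field k] [Group G] [AddCommGroup V] [Module k V]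
    (ρ : Representation k G V) : Prop :=
  ∀ (p q : Submodule k V) (hp : RepInvariant ρ p) (hq : RepInvariant ρ q),
    RepIrreducible (RepRestrict ρ p hp) → RepIrreducible (RepRestrict ρ q hq) →
    RepIso (RepRestrict ρ p hp) (RepRestrict ρ q hq)

/-- The base change (extension of scalars) of a representation along `R → K`. -/
def RepBaseChange (R K : Type*) [CommRing R] [CommRing K] [Algebra R K]
    {G V : Type*} [Group G] [AddCommGroup V] [Module R V] (ρ : Representation R G V) :
    Representation K G (K ⊗[R] V) where
  toFun g := LinearMap.baseChange K (ρ g)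
  map_one' := by simpa using LinearMap.baseChange_one R K (M := V)
  map_mul' g h := by simpa using LinearMap.baseChange_mul (A := K) (ρ g) (ρ h)

section Subrepresentations

variable {k G V : Type*} [Field k] [Group G] [AddCommGroup V] [Module k V]

/-- A nonzero invariant subspace of a finite-dimensional representation contains an irreducible
subrepresentation. -/
theorem RepInvariant.exists_irreducible_le [FiniteDimensional k V] {ρ : Representation k G V}
    {p : Submodule k V} (hp : RepInvariant ρ p) (hp0 : p ≠ ⊥) :
    ∃ (s : Submodule k V) (hs : RepInvariant ρ s), s ≤ p ∧ RepIrreducible (RepRestrict ρ s hs) := by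
  obtain ⟨s, ⟨hs, hs0, hsp⟩, hmin⟩ := (wellFounded_lt (α := Submodule k V)).has_min
    {s | RepInvariant ρ s ∧ s ≠ ⊥ ∧ s ≤ p} ⟨p, hp, hp0, le_rfl⟩
  refine ⟨s, hs, hsp, (Submodule.nontrivial_iff_ne_bot).2 hs0, fun r hr => ?_⟩
  by_contra! hcon
  have hle : r.map s.subtype ≤ s := Submodule.map_subtype_le s r
  refine hmin (r.map s.subtype) ⟨?_, ?_, hle.trans hsp⟩ (lt_of_le_of_ne hle ?_)
  · rintro g _ ⟨v, hv, rfl⟩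
    exact ⟨_, hr g v hv, rfl⟩
  · refine fun h => hcon.1 (Submodule.map_injective_of_injective s.injective_subtype ?_)
    rw [h, Submodule.map_bot]
  · refine fun h => hcon.2 (Submodule.map_injective_of_injective s.injective_subtype ?_)
    rw [h, Submodule.map_subtype_top]

/-- Schur's lemma: a nonzero equivariant map between irreducible representations is an
equivalence. -/
theorem RepIrreducible.repIso_of_ne_zero {W : Type*} [AddCommGroup W] [Module k W]
    {ρ : Representation k G V} {σ : Representation k G W} (hρ : RepIrreducible ρ)
    (hσ : RepIrreducible σ) (f : V →ₗ[k] W) (hf : ∀ g v, f (ρ g v) = σ g (f v)) (hf0 : f ≠ 0) :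
    RepIso ρ σ := by
  have hker : LinearMap.ker f = ⊥ := by
    refine (hρ.2 _ fun g v hv => ?_).resolve_right fun h => hf0 (LinearMap.ker_eq_top.1 h)
    rw [LinearMap.mem_ker] at hv ⊢
    rw [hf, hv, map_zero]
  have hrange : LinearMap.range f = ⊤ := by
    refine (hσ.2 _ ?_).resolve_left fun h => hf0 (LinearMap.range_eq_bot.1 h)
    rintro g _ ⟨v, rfl⟩
    exact ⟨ρ g v, hf g v⟩
  exact ⟨LinearEquiv.ofBijective f ⟨LinearMap.ker_eq_bot.1 hker, LinearMap.range_eq_top.1 hrange⟩,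
    hf⟩

/-- An equivariant map from a subrepresentation extends, up to the factor `|G|`, to an equivariant
map on the whole representation. -/
theorem RepInvariant.exists_equivariant_extend [Finite G] {W : Type*} [AddCommGroup W] [Module k W]
    {ρ : Representation k G V} {σ : Representation k G W} {s : Submodule k V}
    (hs : RepInvariant ρ s) (φ : s →ₗ[k] W)
    (hφ : ∀ g v, φ (RepRestrict ρ s hs g v) = σ g (φ v)) :
    ∃ F : V →ₗ[k] W, (∀ g v, F (ρ g v) = σ g (F v)) ∧ ∀ v : s, F v = (Nat.card G : k) • φ v := by
  have := Fintype.ofFinite G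
  obtain ⟨F₀, hF₀⟩ := LinearMap.exists_extend φ
  refine ⟨∑ x : G, σ x⁻¹ ∘ₗ F₀ ∘ₗ ρ x, fun g v => ?_, fun v => ?_⟩
  · simp only [LinearMap.sum_apply, LinearMap.comp_apply, map_sum]
    refine Fintype.sum_equiv (Equiv.mulRight g) _ _ fun x => ?_
    simp [← Module.End.mul_apply, ← map_mul]
  · have key : ∀ x : G, σ x⁻¹ (F₀ (ρ x v)) = φ v := fun x => by
      have h₁ : F₀ (ρ x v) = φ (RepRestrict ρ s hs x v) :=
        LinearMap.congr_fun hF₀ (RepRestrict ρ s hs x v)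
      rw [h₁, hφ, ← Module.End.mul_apply, ← map_mul, inv_mul_cancel, map_one, Module.End.one_apply]
    simp [key, Nat.card_eq_fintype_card, Nat.cast_smul_eq_nsmul]

end Subrepresentations

section BaseChange

variable {k V K : Type*} [Field k] [Field K] [Algebra k K] [AddCommGroup V] [Module k V]

variable (V) in
/-- The map `K ⊗ V → V` contracting the first factor with a functional on `K`. -/
def TensorProduct.contractScalar (l : K →ₗ[k] k) : K ⊗[k] V →ₗ[k] V :=
  TensorProduct.lid k V ∘ₗ l.rTensor V

@[simp]
theorem TensorProduct.contractScalar_tmul (l : K →ₗ[k] k) (a : K) (v : V) :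
    TensorProduct.contractScalar V l (a ⊗ₜ[k] v) = l a • v := by
  simp [TensorProduct.contractScalar]

theorem TensorProduct.contractScalar_baseChange (l : K →ₗ[k] k) (f : V →ₗ[k] V) (x : K ⊗[k] V) :
    TensorProduct.contractScalar V l (f.baseChange K x) = f (TensorProduct.contractScalar V l x) := by
  induction x with
  | zero => simp
  | tmul a v => simp
  | add x y hx hy => simp [hx, hy]

theorem TensorProduct.contractScalar_mem (l : K →ₗ[k] k) {p : Submodule k V} {x : K ⊗[k] V}
    (hx : x ∈ p.baseChange K) : TensorProduct.contractScalar V l x ∈ p := by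
  obtain ⟨y, rfl⟩ := hx
  induction y with
  | zero => simp
  | tmul a v => simpa using p.smul_mem _ v.2
  | add x y hx hy => simpa using p.add_mem hx hy

theorem TensorProduct.exists_contractScalar_ne_zero {x : K ⊗[k] V} (hx : x ≠ 0) :
    ∃ l : K →ₗ[k] k, TensorProduct.contractScalar V l x ≠ 0 := by
  classical
  by_contra! hcon
  let b := Module.Basis.ofVectorSpace k K
  refine hx ((TensorProduct.equivFinsuppOfBasisLeft b).injective ?_)
  ext i
  rw [map_zero, Finsupp.zero_apply, ← hcon (b.coord i)]
  clear hcon hx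
  induction x with
  | zero => simp
  | tmul a v => simp
  | add x y hx hy => simp [hx, hy]

theorem RepInvariant.baseChange {G : Type*} [Group G] {ρ : Representation k G V}
    {p : Submodule k V} (hp : RepInvariant ρ p) :
    RepInvariant (RepBaseChange k K ρ) (p.baseChange K) := by
  intro g x hx
  obtain ⟨y, rfl⟩ := hx
  induction y with
  | zero => simp
  | tmul a v => exact Submodule.tmul_mem_baseChange_of_mem a (hp g v v.2)
  | add x y hx hy => simpa using Submodule.add_mem _ hx hy

theorem Submodule.baseChange_ne_bot {p : Submodule k V} (hp : p ≠ ⊥) : p.baseChange K ≠ ⊥ := by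
  obtain ⟨v, hv, hv0⟩ := p.ne_bot_iff.1 hp
  refine (Submodule.ne_bot_iff _).2 ⟨1 ⊗ₜ v, Submodule.tmul_mem_baseChange_of_mem 1 hv, fun h => ?_⟩
  exact hv0 (Module.FaithfullyFlat.tensorProduct_mk_injective (A := k) (B := K) V (by simpa using h))

/-- Homogeneity descends along a field extension in which the order of the group is invertible. -/
theorem RepHomogeneous.of_baseChange {G : Type*} [Group G] [Finite G] [FiniteDimensional k V]
    {ρ : Representation k G V} (hG : (Nat.card G : K) ≠ 0)
    (h : RepHomogeneous (RepBaseChange k K ρ)) : RepHomogeneous ρ := by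
  intro p q hp hq hpi hqi
  obtain ⟨P, hP, hPp, hPi⟩ := (hp.baseChange (K := K)).exists_irreducible_le
    (Submodule.baseChange_ne_bot (Submodule.nontrivial_iff_ne_bot.1 hpi.1))
  obtain ⟨Q, hQ, hQq, hQi⟩ := (hq.baseChange (K := K)).exists_irreducible_le
    (Submodule.baseChange_ne_bot (Submodule.nontrivial_iff_ne_bot.1 hqi.1))
  obtain ⟨e, he⟩ := h P Q hP hQ hPi hQi
  obtain ⟨F, hF, hFP⟩ := hP.exists_equivariant_extend (W := Q)
    (σ := RepRestrict (RepBaseChange k K ρ) Q hQ) e.toLinearMap fun g v => he g v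
  obtain ⟨v, hv⟩ : ∃ v : p, F (1 ⊗ₜ (v : V)) ≠ 0 := by
    by_contra! hcon
    have hle : p.baseChange K ≤ LinearMap.ker F := by
      rw [Submodule.baseChange_eq_span, Submodule.span_le]
      rintro _ ⟨v, hv, rfl⟩
      exact hcon ⟨v, hv⟩
    have := hPi.1
    obtain ⟨w, hw⟩ := exists_ne (0 : P)
    have hw' := hFP w
    rw [LinearMap.mem_ker.1 (hle (hPp w.2))] at hw'
    exact smul_ne_zero hG (e.map_ne_zero_iff.2 hw) hw'.symm
  obtain ⟨l, hl⟩ := TensorProduct.exists_contractScalar_ne_zero (k := k)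
    (x := (F (1 ⊗ₜ (v : V)) : K ⊗[k] V)) (by simpa using hv)
  let f : V →ₗ[k] V := TensorProduct.contractScalar V l ∘ₗ
    ((Q.subtype ∘ₗ F).restrictScalars k) ∘ₗ TensorProduct.mk k K V 1
  have hfq : ∀ x, f x ∈ q := fun x => TensorProduct.contractScalar_mem l (hQq (F _).2)
  have hf : ∀ g x, f (ρ g x) = ρ g (f x) := fun g x => by
    have h₁ : F (1 ⊗ₜ ρ g x) = RepRestrict _ Q hQ g (F (1 ⊗ₜ x)) := hF g (1 ⊗ₜ x)
    change TensorProduct.contractScalar V l (F (1 ⊗ₜ ρ g x) : Q) = _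
    rw [h₁]
    exact TensorProduct.contractScalar_baseChange l (ρ g) _
  refine hpi.repIso_of_ne_zero hqi ((f.codRestrict q hfq) ∘ₗ p.subtype)
    (fun g x => Subtype.ext (hf g x)) fun h0 => hl ?_
  exact congrArg Subtype.val (LinearMap.congr_fun h0 v)

end BaseChange

/-- Let `G` be a finite group, `ρ` a finite-dimensional representation of `G`
over `ℚ`, and `K` a field extension of `ℚ`. If the base-changed representation `K ⊗_ℚ ρ` of
`G` over `K` is homogeneous, then `ρ` is homogeneous. -/
theorem statement0 {G : Type*} [Group G] [Finite G]
    {V : Type*} [AddCommGroup V] [Module ℚ V] [FiniteDimensional ℚ V]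
    (ρ : Representation ℚ G V)
    (K : Type*) [Field K] [Algebra ℚ K]
    (h : RepHomogeneous (RepBaseChange ℚ K ρ)) :
    RepHomogeneous ρ := by
  have := charZero_of_injective_algebraMap (algebraMap ℚ K).injective
  exact h.of_baseChange (Nat.cast_ne_zero.2 Nat.card_pos.ne')

end
end

section
/- Let h₁, h₂ ∈ GL₂₀(ℂ) be the linear maps h₁ : (z₁,…,z₂₀) ↦ (z₅,z₆,…,z₂₀,z₁,z₂,z₃,z₄) and h₂ : (z₁,…,z₂₀) ↦ (−iz₁, iz₂, iz₃, −iz₄, −z₆, z₅, z₈, −z₇, −iz₁₀, −iz₉, iz₁₂, iz₁₁, −iz₁₆, −iz₁₅, −iz₁₄, −iz₁₃, −iz₂₀, −iz₁₉, iz₁₈, iz₁₇). Then the subgroup G = ⟨h₁, h₂⟩ of GL₂₀(ℂ) is finite of order 1280, its tautological 20-dimensional representation on ℂ²⁰ is irreducible, every element of G has 1 as an eigenvalue, and every element of G preserves the nondegenerate alternating bilinear form ω = Σ_{j=1}^{10} e*_{2j−1} ∧ e*_{2j} (so the representation is of quaternionic type). -/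
open scoped TensorProduct

noncomputable section

/-- The character of a finite-dimensional representation, `χ_ρ(g) = tr ρ(g)`. -/
def repChar {k G V : Type*} [Field k] [Group G] [AddCommGroup V] [Module k V]
    (ρ : Representation k G V) (g : G) : k :=
  LinearMap.trace k V (ρ g)

/-- The Frobenius–Schur indicator `ι(ρ) = (1/|G|) ∑_{g ∈ G} χ_ρ(g²)` (stated with `Nat.card`
and `finsum`, which for a finite group agree with the usual cardinality and sum). -/
def FSindicator {k G V : Type*} [Field k] [Group G] [AddCommGroup V] [Module k V]
    (ρ : Representation k G V) : k :=
  (Nat.card G : k)⁻¹ * ∑ᶠ g : G, repChar ρ (g * g)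


/-- The monomial linear map `z ↦ (i ↦ c i * z (p i))`. -/
def monoMap {n : ℕ} (c : Fin n → ℂ) (p : Equiv.Perm (Fin n)) :
    (Fin n → ℂ) →ₗ[ℂ] (Fin n → ℂ) where
  toFun z := fun i => c i * z (p i)
  map_add' x y := by funext i; simp [mul_add]
  map_smul' a x := by funext i; simp; ring

/-- The monomial linear automorphism `z ↦ (i ↦ c i * z (p i))`, for invertible
coefficients `c`. -/
def monoEquiv {n : ℕ} (c : Fin n → ℂˣ) (p : Equiv.Perm (Fin n)) :
    (Fin n → ℂ) ≃ₗ[ℂ] (Fin n → ℂ) :=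
  LinearEquiv.ofLinear (monoMap (fun i => (c i : ℂ)) p)
    (monoMap (fun i => ((c (p⁻¹ i) : ℂ)⁻¹)) p⁻¹)
    (by
      refine LinearMap.ext fun z => funext fun i => ?_
      simp [monoMap, ← mul_assoc])
    (by
      refine LinearMap.ext fun z => funext fun i => ?_
      simp [monoMap, ← mul_assoc])

/-- The tautological representation of a subgroup of `GLₙ(ℂ)` on `ℂⁿ`. -/
def tautRep {n : ℕ} (G : Subgroup ((Fin n → ℂ) ≃ₗ[ℂ] (Fin n → ℂ))) :
    Representation ℂ G (Fin n → ℂ) where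
  toFun g := (g : (Fin n → ℂ) ≃ₗ[ℂ] (Fin n → ℂ)).toLinearMap
  map_one' := rfl
  map_mul' _ _ := rfl


/-- The standard symplectic form `ω = ∑_{j=1}^{10} e*_{2j−1} ∧ e*_{2j}` on `ℂ²⁰`,
`ω(v, w) = ∑_{j=1}^{10} (v_{2j−1} w_{2j} − v_{2j} w_{2j−1})`. -/
def omega20 : (Fin 20 → ℂ) →ₗ[ℂ] (Fin 20 → ℂ) →ₗ[ℂ] ℂ :=
  LinearMap.mk₂ ℂ
    (fun v w => ∑ j : Fin 10,
      (v ⟨2 * j.1, by omega⟩ * w ⟨2 * j.1 + 1, by omega⟩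
        - v ⟨2 * j.1 + 1, by omega⟩ * w ⟨2 * j.1, by omega⟩))
    (by
      intro v v' w
      rw [← Finset.sum_add_distrib]
      exact Finset.sum_congr rfl fun j _ => by simp; ring)
    (by
      intro a v w
      rw [Finset.smul_sum]
      exact Finset.sum_congr rfl fun j _ => by simp; ring)
    (by
      intro v w w'
      rw [← Finset.sum_add_distrib]
      exact Finset.sum_congr rfl fun j _ => by simp; ring)
    (by
      intro a v w
      rw [Finset.smul_sum]
      exact Finset.sum_congr rfl fun j _ => by simp; ring)


/-- The imaginary unit `i`, as a unit of `ℂ`. -/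
def iUnit : ℂˣ :=
  ⟨Complex.I, -Complex.I, by rw [mul_neg, Complex.I_mul_I, neg_neg],
    by rw [neg_mul, Complex.I_mul_I, neg_neg]⟩

/-- The generator `h₁ : (z₁,…,z₂₀) ↦ (z₅,z₆,…,z₂₀,z₁,z₂,z₃,z₄)`. -/
def gen20₁ : (Fin 20 → ℂ) ≃ₗ[ℂ] (Fin 20 → ℂ) :=
  monoEquiv (fun _ => 1) (Equiv.addRight (4 : Fin 20))

/-- The permutation underlying the generator `h₂`. -/
def perm20₂ : Equiv.Perm (Fin 20) :=
  ⟨![0, 1, 2, 3, 5, 4, 7, 6, 9, 8, 11, 10, 15, 14, 13, 12, 19, 18, 17, 16],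
    ![0, 1, 2, 3, 5, 4, 7, 6, 9, 8, 11, 10, 15, 14, 13, 12, 19, 18, 17, 16],
    by decide, by decide⟩

/-- The coefficients of the generator `h₂`. -/
def coeff20₂ : Fin 20 → ℂˣ :=
  ![-iUnit, iUnit, iUnit, -iUnit, -1, 1, 1, -1, -iUnit, -iUnit, iUnit, iUnit,
    -iUnit, -iUnit, -iUnit, -iUnit, -iUnit, -iUnit, iUnit, iUnit]

/-- The generator `h₂ : (z₁,…,z₂₀) ↦ (−iz₁, iz₂, iz₃, −iz₄, −z₆, z₅, z₈, −z₇, −iz₁₀, −iz₉,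
iz₁₂, iz₁₁, −iz₁₆, −iz₁₅, −iz₁₄, −iz₁₃, −iz₂₀, −iz₁₉, iz₁₈, iz₁₇)`. -/
def gen20₂ : (Fin 20 → ℂ) ≃ₗ[ℂ] (Fin 20 → ℂ) :=
  monoEquiv coeff20₂ perm20₂

/-- The subgroup `G = ⟨h₁, h₂⟩` of `GL₂₀(ℂ)`. -/
def G1280 : Subgroup ((Fin 20 → ℂ) ≃ₗ[ℂ] (Fin 20 → ℂ)) :=
  Subgroup.closure {gen20₁, gen20₂}

/-- A monomial endomorphism `z ↦ (j ↦ i ^ phase j * z (perm j))` of `ℂ²⁰`, recorded by its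
phases and its action on indices. -/
@[ext] structure MonomialData where
  phase : Fin 20 → Fin 4
  perm : Fin 20 → Fin 20

namespace MonomialData

instance : Monoid MonomialData where
  mul m n := ⟨fun i => m.phase i + n.phase (m.perm i), fun i => n.perm (m.perm i)⟩
  one := ⟨fun _ => 0, fun i => i⟩
  mul_assoc a b c := MonomialData.ext (funext fun _ => add_assoc _ _ _) rfl
  one_mul a := MonomialData.ext (funext fun _ => zero_add _) rfl
  mul_one a := MonomialData.ext (funext fun _ => add_zero _) rfl

theorem mul_phase (m n : MonomialData) (i : Fin 20) :
    (m * n).phase i = m.phase i + n.phase (m.perm i) := rfl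

theorem mul_perm (m n : MonomialData) (i : Fin 20) :
    (m * n).perm i = n.perm (m.perm i) := rfl

theorem one_phase (i : Fin 20) : (1 : MonomialData).phase i = 0 := rfl

theorem one_perm (i : Fin 20) : (1 : MonomialData).perm i = i := rfl

/-- The index of the four-dimensional block containing the coordinate `i`. -/
def block (i : Fin 20) : Fin 5 := ⟨i / 4, by omega⟩

/-- The first coordinate of a block. -/
def firstIndex (b : Fin 5) : Fin 20 := ⟨4 * b, by omega⟩

/-- The cyclic shift of the blocks, `h₁ ^ a`. -/
def shift (a : Fin 5) : MonomialData := ⟨fun _ => 0, fun i => i + firstIndex a⟩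

/-- The data of the generator `h₂`. -/
def twist : MonomialData :=
  ⟨![3, 1, 1, 3, 2, 0, 0, 2, 3, 3, 1, 1, 3, 3, 3, 3, 3, 3, 1, 1],
    ![0, 1, 2, 3, 5, 4, 7, 6, 9, 8, 11, 10, 15, 14, 13, 12, 19, 18, 17, 16]⟩

/-- The conjugates of `h₂` under the cyclic shift. -/
def conjTwist (a : Fin 5) : MonomialData := shift (-a) * twist * shift a

/-- The ordered product of those of the first four conjugates of `h₂` that are selected by the
binary digits of `w`. -/
def twistProd (w : Fin 16) : MonomialData :=
  (if w.val.testBit 0 then conjTwist 0 else 1) * (if w.val.testBit 1 then conjTwist 1 else 1) *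
    (if w.val.testBit 2 then conjTwist 2 else 1) * (if w.val.testBit 3 then conjTwist 3 else 1)

/-- The phase `0` or `2` of a sign `1` or `-1`. -/
def signPhase (x : ZMod 2) : Fin 4 := if x = 0 then 0 else 2

/-- The diagonal map acting on each block by a sign. -/
def blockSign (s : Fin 5 → ZMod 2) : MonomialData :=
  ⟨fun i => signPhase (s (block i)), fun i => i⟩

/-- The blockwise sign by which two monomial maps with proportional blocks differ. -/
def signDiff (m n : MonomialData) (b : Fin 5) : ZMod 2 :=
  if m.phase (firstIndex b) = n.phase (firstIndex b) then 0 else 1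

theorem shift_zero : shift 0 = 1 := by
  ext i <;> revert i <;> decide

theorem shift_mul_shift (a b : Fin 5) : shift a * shift b = shift (a + b) := by
  have h : ∀ a b : Fin 5, ∀ i, i + firstIndex a + firstIndex b = i + firstIndex (a + b) := by
    decide +kernel
  exact MonomialData.ext rfl (funext (h a b))

theorem twist_mul_shift (a : Fin 5) : twist * shift a = shift a * conjTwist a := by
  rw [conjTwist, ← mul_assoc, ← mul_assoc, shift_mul_shift, add_neg_cancel, shift_zero, one_mul]

/-- The coset, modulo blockwise signs, of a conjugate of `h₂`. -/
def twistMask (a : Fin 5) : Fin 16 := ![1, 2, 4, 8, 15] a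

/-- The correction sign in the multiplication of normal forms. -/
def cocycle (a : Fin 5) (w : Fin 16) : Fin 5 → ZMod 2 :=
  signDiff (conjTwist a * twistProd w) (twistProd (twistMask a ^^^ w))

theorem conjTwist_mul_twistProd (a : Fin 5) (w : Fin 16) :
    conjTwist a * twistProd w = twistProd (twistMask a ^^^ w) * blockSign (cocycle a w) := by
  have h : ∀ a w, ∀ i,
      (conjTwist a * twistProd w).phase i =
          (twistProd (twistMask a ^^^ w) * blockSign (cocycle a w)).phase i ∧
        (conjTwist a * twistProd w).perm i =
          (twistProd (twistMask a ^^^ w) * blockSign (cocycle a w)).perm i := by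
    decide +kernel
  exact MonomialData.ext (funext fun i => (h a w i).1) (funext fun i => (h a w i).2)

theorem sum_cocycle (a : Fin 5) (w : Fin 16) : ∑ b, cocycle a w b = 0 := by
  revert a w
  decide +kernel

/-- The blockwise sign of the square of `twistProd w`. -/
def squareSign (w : Fin 16) : Fin 5 → ZMod 2 := signDiff (twistProd w * twistProd w) 1

theorem twistProd_mul_self (w : Fin 16) :
    twistProd w * twistProd w = blockSign (squareSign w) := by
  have h : ∀ w, ∀ i,
      (twistProd w * twistProd w).phase i = (blockSign (squareSign w)).phase i ∧
        (twistProd w * twistProd w).perm i = (blockSign (squareSign w)).perm i := by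
    decide +kernel
  exact MonomialData.ext (funext fun i => (h w i).1) (funext fun i => (h w i).2)

theorem block_twistProd_perm (w : Fin 16) (i : Fin 20) :
    block ((twistProd w).perm i) = block i := by
  revert w i
  decide +kernel

theorem block_shift_perm (a : Fin 5) (i : Fin 20) : block ((shift a).perm i) = block i + a := by
  revert a i
  decide +kernel

/-- The normal form of the elements of `G`. -/
def normalForm (a : Fin 5) (w : Fin 16) (s : Fin 5 → ZMod 2) : MonomialData :=
  shift a * (twistProd w * blockSign s)

theorem sum_squareSign : ∑ w, ∑ i, (if squareSign w (block i) = 0 then 1 else -1 : ℤ) = -80 := by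
  decide +kernel

theorem shift_mul_twistProd_five_cycle : ∀ a, a ≠ 0 → ∀ w,
    ((shift a * twistProd w) ^ 5).perm 0 = 0 ∧ ((shift a * twistProd w) ^ 5).phase 0 = 0 ∧
      ∀ k < 5, k ≠ 0 → ((shift a * twistProd w) ^ k).perm 0 ≠ 0 := by
  decide +kernel

theorem twistProd_short_cycle : ∀ w, w ≠ 0 → ∃ i,
    (twistProd w).perm i ≠ i ∧ squareSign w (block i) = 0 ∨
      (twistProd w).perm i = i ∧ (twistProd w).phase i = 0 ∧
        ∃ j, block j = block i ∧ (twistProd w).perm j = j ∧ (twistProd w).phase j = 2 := by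
  decide +kernel

theorem I_pow_fin_add (x y : Fin 4) :
    Complex.I ^ (x + y).val = Complex.I ^ x.val * Complex.I ^ y.val := by
  rw [← pow_add, Fin.val_add]
  conv_rhs => rw [← Nat.mod_add_div (x.val + y.val) 4, pow_add, pow_mul, Complex.I_pow_four,
    one_pow, mul_one]

/-- The endomorphism of `ℂ²⁰` encoded by monomial data. -/
def toEnd : MonomialData →* Module.End ℂ (Fin 20 → ℂ) where
  toFun m :=
    { toFun := fun z i => Complex.I ^ (m.phase i).val * z (m.perm i)
      map_add' := fun x y => funext fun i => mul_add _ _ _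
      map_smul' := fun a x => funext fun i => mul_left_comm _ _ _ }
  map_one' := by
    ext1; ext1; ext1
    simp [one_phase, one_perm]
  map_mul' m n := by
    refine LinearMap.ext fun z => funext fun i => ?_
    simp [mul_phase, mul_perm, I_pow_fin_add, mul_assoc]

theorem toEnd_apply (m : MonomialData) (z : Fin 20 → ℂ) (i : Fin 20) :
    toEnd m z i = Complex.I ^ (m.phase i).val * z (m.perm i) := rfl

theorem I_pow_injective : Function.Injective fun x : Fin 4 => Complex.I ^ x.val := by
  intro x y
  fin_cases x <;> fin_cases y <;> norm_num [Complex.ext_iff, pow_succ]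

theorem toEnd_injective : Function.Injective toEnd := by
  intro m n h
  have hperm : m.perm = n.perm := by
    funext i
    by_contra hne
    have := congrFun (LinearMap.congr_fun h (Pi.single (m.perm i) 1)) i
    simp [toEnd_apply, Ne.symm hne] at this
  refine MonomialData.ext (funext fun i => ?_) hperm
  have := congrFun (LinearMap.congr_fun h 1) i
  exact I_pow_injective (by simpa [toEnd_apply] using this)

theorem trace_toEnd (m : MonomialData) :
    LinearMap.trace ℂ (Fin 20 → ℂ) (toEnd m) =
      ∑ i, if m.perm i = i then Complex.I ^ (m.phase i).val else 0 := by
  rw [LinearMap.trace_eq_matrix_trace ℂ (Pi.basisFun ℂ (Fin 20)), Matrix.trace]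
  refine Finset.sum_congr rfl fun i _ => ?_
  simp [toEnd_apply, Pi.single_apply]

theorem pow_perm (m : MonomialData) (n : ℕ) : (m ^ n).perm = m.perm^[n] := by
  induction n with
  | zero => rfl
  | succ n ih => rw [pow_succ', Function.iterate_succ, ← ih]; rfl

/-- A monomial map one of whose cycles has trivial total phase has the eigenvalue `1`. -/
theorem hasEigenvalue_one {m : MonomialData} (hm : Function.Injective m.perm) {n : ℕ}
    (hn : n ≠ 0) {i : Fin 20} (hperm : (m ^ n).perm i = i) (hphase : (m ^ n).phase i = 0)
    (hmin : ∀ k < n, k ≠ 0 → (m ^ k).perm i ≠ i) :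
    Module.End.HasEigenvalue (toEnd m) 1 := by
  let e : Fin 20 → ℂ := Pi.single i 1
  let v : Fin 20 → ℂ := ∑ k ∈ Finset.range n, toEnd (m ^ k) e
  have hcycle : toEnd (m ^ n) e = e := by
    funext j
    rw [toEnd_apply]
    by_cases hj : j = i
    · rw [hj, hperm, hphase]; simp
    · have hinj : Function.Injective (m ^ n).perm := by rw [pow_perm]; exact hm.iterate n
      have : (m ^ n).perm j ≠ i := fun h => hj (hinj (h.trans hperm.symm))
      simp [e, this, hj]
  have hfix : toEnd m v = v := by
    have h₁ : toEnd m v = ∑ k ∈ Finset.range n, toEnd (m ^ (k + 1)) e := by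
      simp only [v, map_sum, pow_succ' m, map_mul, Module.End.mul_apply]
    have h₂ := Finset.sum_range_succ (fun k => toEnd (m ^ k) e) n
    rw [Finset.sum_range_succ', hcycle] at h₂
    rw [pow_zero, map_one, Module.End.one_apply] at h₂
    exact h₁.trans (add_right_cancel h₂)
  have hvi : v i = 1 := by
    simp only [v, Finset.sum_apply]
    rw [Finset.sum_eq_single_of_mem 0 (Finset.mem_range.2 (Nat.pos_of_ne_zero hn))]
    · simp [e]
    · intro k hk hk0
      have : e ((m ^ k).perm i) = 0 :=
        Pi.single_eq_of_ne (hmin k (Finset.mem_range.1 hk) hk0) 1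
      rw [toEnd_apply, this, mul_zero]
  refine Module.End.hasEigenvalue_of_hasEigenvector (x := v)
    ⟨Module.End.mem_eigenspace_iff.2 (by rw [hfix, one_smul]), fun h => ?_⟩
  rw [h] at hvi
  simp at hvi

theorem shift_perm_injective (a : Fin 5) : Function.Injective (shift a).perm :=
  add_left_injective _

theorem twistProd_perm_injective (w : Fin 16) : Function.Injective (twistProd w).perm := by
  have h : ∀ w, ∀ i, (twistProd w * twistProd w).perm i = i := fun w i => by
    rw [twistProd_mul_self]; rfl
  exact fun i j hij => by rw [← h w i, ← h w j, mul_perm, mul_perm, hij]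

theorem signPhase_add (x y : ZMod 2) : signPhase (x + y) = signPhase x + signPhase y := by
  revert x y
  decide

theorem signPhase_injective : Function.Injective signPhase := by
  unfold Function.Injective
  decide

theorem blockSign_mul_blockSign (s t : Fin 5 → ZMod 2) :
    blockSign s * blockSign t = blockSign (s + t) :=
  MonomialData.ext (funext fun _ => (signPhase_add _ _).symm) rfl

theorem blockSign_mul_self (s : Fin 5 → ZMod 2) : blockSign s * blockSign s = 1 := by
  rw [blockSign_mul_blockSign, CharTwo.add_self_eq_zero]
  rfl

theorem blockSign_mul_twistProd (s : Fin 5 → ZMod 2) (w : Fin 16) :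
    blockSign s * twistProd w = twistProd w * blockSign s := by
  refine MonomialData.ext (funext fun i => ?_) rfl
  rw [mul_phase, mul_phase, add_comm]
  simp [blockSign, block_twistProd_perm]

theorem block_normalForm_perm (a : Fin 5) (w : Fin 16) (s : Fin 5 → ZMod 2) (i : Fin 20) :
    block ((normalForm a w s).perm i) = block i + a := by
  rw [normalForm, mul_perm, mul_perm]
  exact (block_twistProd_perm _ _).trans (block_shift_perm _ _)

theorem shift_mul_normalForm (c a : Fin 5) (w : Fin 16) (s : Fin 5 → ZMod 2) :
    shift c * normalForm a w s = normalForm (c + a) w s := by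
  rw [normalForm, ← mul_assoc, shift_mul_shift, normalForm]

theorem normalForm_zero_mul_self (w : Fin 16) (s : Fin 5 → ZMod 2) :
    normalForm 0 w s * normalForm 0 w s = blockSign (squareSign w) := by
  rw [normalForm, shift_zero, one_mul, mul_assoc, ← mul_assoc (blockSign s),
    blockSign_mul_twistProd, mul_assoc, blockSign_mul_self, mul_one, twistProd_mul_self]

theorem blockSign_mul_shift (s : Fin 5 → ZMod 2) (a : Fin 5) :
    blockSign s * shift a = shift a * blockSign (fun b => s (b - a)) := by
  refine MonomialData.ext (funext fun i => ?_) rfl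
  rw [mul_phase, mul_phase, add_comm]
  simp only [blockSign, block_shift_perm, add_sub_cancel_right]

/-- The normal forms over a nontrivial shift are conjugate to those without sign. -/
theorem normalForm_eq_conj {a : Fin 5} (ha : a ≠ 0) (w : Fin 16) {s : Fin 5 → ZMod 2}
    (hs : ∑ b, s b = 0) : ∃ r : Fin 5 → ZMod 2,
      normalForm a w s = blockSign r * (shift a * twistProd w) * blockSign r := by
  let r : Fin 5 → ZMod 2 := fun b => s (b + 2 * a) + s (b + 4 * a)
  have hr : (fun b => r (b - a)) + r = s := by
    have key : ∀ a : Fin 5, a ≠ 0 → ∀ b : Fin 5, ∀ s : Fin 5 → ZMod 2, ∑ b, s b = 0 →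
        s (b - a + 2 * a) + s (b - a + 4 * a) + (s (b + 2 * a) + s (b + 4 * a)) = s b := by
      decide +kernel
    exact funext fun b => key a ha b s hs
  refine ⟨r, ?_⟩
  rw [← mul_assoc, blockSign_mul_shift, mul_assoc (shift a), blockSign_mul_twistProd, mul_assoc,
    mul_assoc (twistProd w), blockSign_mul_blockSign, hr, normalForm]

theorem hasEigenvalue_one_conj {T f : Module.End ℂ (Fin 20 → ℂ)} (hT : T * T = 1)
    (hf : Module.End.HasEigenvalue f 1) : Module.End.HasEigenvalue (T * f * T) 1 := by
  obtain ⟨v, hv⟩ := hf.exists_hasEigenvector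
  have hTT (u : Fin 20 → ℂ) : T (T u) = u := LinearMap.congr_fun hT u
  refine Module.End.hasEigenvalue_of_hasEigenvector (x := T v)
    ⟨Module.End.mem_eigenspace_iff.2 ?_, fun h => hv.2 ?_⟩
  · rw [Module.End.mul_apply, Module.End.mul_apply, hTT, hv.apply_eq_smul, one_smul, one_smul]
  · rw [← hTT v, h, map_zero]

theorem normalForm_zero_hasEigenvalue_one (w : Fin 16) {s : Fin 5 → ZMod 2}
    (hs : ∑ b, s b = 0) : Module.End.HasEigenvalue (toEnd (normalForm 0 w s)) 1 := by
  have hinj : Function.Injective (normalForm 0 w s).perm :=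
    (twistProd_perm_injective w).comp (shift_perm_injective 0)
  have hperm (i : Fin 20) : (normalForm 0 w s).perm i = (twistProd w).perm i := by
    rw [normalForm, shift_zero, one_mul]
    rfl
  have hphase (i : Fin 20) :
      (normalForm 0 w s).phase i = (twistProd w).phase i + signPhase (s (block i)) := by
    rw [normalForm, shift_zero, one_mul, mul_phase]
    simp [blockSign, block_twistProd_perm]
  have hfixed {i : Fin 20} (h : (twistProd w).perm i = i)
      (h' : (twistProd w).phase i + signPhase (s (block i)) = 0) :
      Module.End.HasEigenvalue (toEnd (normalForm 0 w s)) 1 :=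
    hasEigenvalue_one hinj one_ne_zero (i := i) (by rw [pow_one, hperm, h])
      (by rw [pow_one, hphase, h']) (fun k hk hk0 => absurd (Nat.lt_one_iff.1 hk) hk0)
  by_cases hw : w = 0
  · have key : ∀ s : Fin 5 → ZMod 2, ∑ b, s b = 0 → ∃ i, s (block i) = 0 := by decide +kernel
    obtain ⟨i, hi⟩ := key s hs
    subst hw
    exact hfixed (i := i) rfl (by rw [hi]; rfl)
  obtain ⟨i, ⟨hi, hsq⟩ | ⟨hi, hi', j, hji, hj, hj'⟩⟩ := twistProd_short_cycle w hw
  · refine hasEigenvalue_one hinj two_ne_zero (i := i) ?_ ?_ fun k hk hk0 => ?_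
    · rw [pow_two, normalForm_zero_mul_self]
      rfl
    · rw [pow_two, normalForm_zero_mul_self]
      simp [blockSign, signPhase, hsq]
    · rw [show k = 1 by omega, pow_one, hperm]
      exact hi
  · by_cases hsi : s (block i) = 0
    · exact hfixed hi (by rw [hi', hsi]; rfl)
    · exact hfixed hj (by rw [hj', hji, signPhase, if_neg hsi]; rfl)

theorem normalForm_hasEigenvalue_one (a : Fin 5) (w : Fin 16) {s : Fin 5 → ZMod 2}
    (hs : ∑ b, s b = 0) : Module.End.HasEigenvalue (toEnd (normalForm a w s)) 1 := by
  by_cases ha : a = 0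
  · rw [ha]
    exact normalForm_zero_hasEigenvalue_one w hs
  · obtain ⟨hperm, hphase, hmin⟩ := shift_mul_twistProd_five_cycle a ha w
    obtain ⟨r, hr⟩ := normalForm_eq_conj ha w hs
    rw [hr, map_mul, map_mul]
    refine hasEigenvalue_one_conj (by rw [← map_mul, blockSign_mul_self, map_one]) ?_
    exact hasEigenvalue_one ((twistProd_perm_injective w).comp (shift_perm_injective a))
      (by norm_num) hperm hphase hmin

theorem twist_mul_normalForm (a : Fin 5) (w : Fin 16) (s : Fin 5 → ZMod 2) :
    twist * normalForm a w s = normalForm a (twistMask a ^^^ w) (cocycle a w + s) := by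
  rw [normalForm, ← mul_assoc, twist_mul_shift, mul_assoc, ← mul_assoc (conjTwist a),
    conjTwist_mul_twistProd, mul_assoc (twistProd _), blockSign_mul_blockSign, normalForm]

theorem twistProd_mul_blockSign_injective {w w' : Fin 16} {s s' : Fin 5 → ZMod 2}
    (h : twistProd w * blockSign s = twistProd w' * blockSign s') : w = w' ∧ s = s' := by
  have hw : w = w' := by
    have key : ∀ w w' : Fin 16, (∀ i, block i = 0 →
        (twistProd w).perm i = (twistProd w').perm i ∧
        (twistProd w).phase i - (twistProd w).phase 0 =
          (twistProd w').phase i - (twistProd w').phase 0) → w = w' := by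
      decide +kernel
    have hphase : ∀ i, (twistProd w).phase i + signPhase (s (block i)) =
        (twistProd w').phase i + signPhase (s' (block i)) := fun i => by
      have := congrFun (congrArg phase h) i
      simpa [mul_phase, blockSign, block_twistProd_perm] using this
    refine key w w' fun i hi => ⟨congrFun (congrArg perm h) i, ?_⟩
    rw [← add_sub_add_right_eq_sub _ _ (signPhase (s (block i))), hphase i, hi,
      show (0 : Fin 5) = block 0 from rfl, hphase 0, add_sub_add_right_eq_sub]
  subst hw
  refine ⟨rfl, funext fun b => signPhase_injective ?_⟩
  have := congrFun (congrArg phase h) (firstIndex b)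
  have hb : block (firstIndex b) = b := by
    clear this
    revert b
    decide
  simpa [mul_phase, blockSign, block_twistProd_perm, hb] using this

theorem normalForm_injective {a a' : Fin 5} {w w' : Fin 16} {s s' : Fin 5 → ZMod 2}
    (h : normalForm a w s = normalForm a' w' s') : a = a' ∧ w = w' ∧ s = s' := by
  have ha : a = a' := by
    have := congrArg (fun m => block (m.perm 0)) h
    simpa [block_normalForm_perm] using this
  subst ha
  refine ⟨rfl, twistProd_mul_blockSign_injective ?_⟩
  have := congrArg (shift (-a) * ·) h
  simpa [normalForm, ← mul_assoc, shift_mul_shift, shift_zero] using this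

theorem trace_normalForm_sq_of_ne_zero {a : Fin 5} (ha : a ≠ 0) (w : Fin 16)
    (s : Fin 5 → ZMod 2) :
    LinearMap.trace ℂ (Fin 20 → ℂ) (toEnd (normalForm a w s * normalForm a w s)) = 0 := by
  rw [trace_toEnd]
  refine Finset.sum_eq_zero fun i _ => if_neg fun h => ?_
  have hb := congrArg block h
  rw [mul_perm, block_normalForm_perm, block_normalForm_perm, add_assoc, add_eq_left] at hb
  have key : ∀ a : Fin 5, a + a = 0 → a = 0 := by decide
  exact ha (key a hb)

theorem trace_normalForm_zero_sq (w : Fin 16) (s : Fin 5 → ZMod 2) :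
    LinearMap.trace ℂ (Fin 20 → ℂ) (toEnd (normalForm 0 w s * normalForm 0 w s)) =
      ((∑ i, (if squareSign w (block i) = 0 then 1 else -1 : ℤ) : ℤ) : ℂ) := by
  rw [normalForm_zero_mul_self, trace_toEnd, Int.cast_sum]
  refine Finset.sum_congr rfl fun i _ => ?_
  by_cases hi : squareSign w (block i) = 0 <;> simp [blockSign, signPhase, hi]

/-- The blockwise signs of product one. -/
abbrev EvenSign : Type := {s : Fin 5 → ZMod 2 // ∑ b, s b = 0}

theorem card_evenSign : Fintype.card EvenSign = 16 := by
  decide +kernel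

theorem sum_trace_normalForm_sq :
    ∑ x : Fin 5 × Fin 16 × EvenSign, LinearMap.trace ℂ (Fin 20 → ℂ)
      (toEnd (normalForm x.1 x.2.1 x.2.2 * normalForm x.1 x.2.1 x.2.2)) = -1280 := by
  rw [Fintype.sum_prod_type, Finset.sum_eq_single_of_mem 0 (Finset.mem_univ _)
    fun a _ ha => Finset.sum_eq_zero fun x _ => trace_normalForm_sq_of_ne_zero ha x.1 x.2]
  rw [Fintype.sum_prod_type_right]
  dsimp only
  simp only [trace_normalForm_zero_sq]
  rw [Finset.sum_const, Finset.card_univ, card_evenSign, ← Int.cast_sum, sum_squareSign]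
  norm_num

end MonomialData

open MonomialData

theorem gen20₁_eq_toEnd : (gen20₁ : (Fin 20 → ℂ) →ₗ[ℂ] (Fin 20 → ℂ)) = toEnd (shift 1) := by
  refine LinearMap.ext fun z => funext fun i => ?_
  change ((1 : ℂˣ) : ℂ) * z (i + 4) = Complex.I ^ 0 * z (i + 4)
  simp

theorem gen20₂_eq_toEnd : (gen20₂ : (Fin 20 → ℂ) →ₗ[ℂ] (Fin 20 → ℂ)) = toEnd twist := by
  refine LinearMap.ext fun z => funext fun i => ?_
  have hc : ∀ i, (coeff20₂ i : ℂ) = Complex.I ^ (twist.phase i).val := by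
    intro i
    fin_cases i <;> simp [coeff20₂, twist, iUnit, pow_succ]
  change (coeff20₂ i : ℂ) * z (twist.perm i) = _
  rw [hc, toEnd_apply]

/-- Monomial data realized by an element of `G`. -/
def realized : Submonoid MonomialData where
  carrier := {m | ∃ g ∈ G1280, (g : (Fin 20 → ℂ) →ₗ[ℂ] (Fin 20 → ℂ)) = toEnd m}
  one_mem' := ⟨1, one_mem _, by rw [map_one]; rfl⟩
  mul_mem' := by
    rintro m n ⟨g, hg, hgm⟩ ⟨h, hh, hhn⟩
    exact ⟨g * h, mul_mem hg hh, by rw [map_mul, ← hgm, ← hhn]; rfl⟩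

theorem shift_one_mem_realized : shift 1 ∈ realized :=
  ⟨gen20₁, Subgroup.subset_closure (Or.inl rfl), gen20₁_eq_toEnd⟩

theorem twist_mem_realized : twist ∈ realized :=
  ⟨gen20₂, Subgroup.subset_closure (Or.inr rfl), gen20₂_eq_toEnd⟩

theorem shift_mem_realized (a : Fin 5) : shift a ∈ realized := by
  induction a using Fin.induction with
  | zero => rw [shift_zero]; exact one_mem _
  | succ a ih =>
    rw [← Fin.coeSucc_eq_succ, ← shift_mul_shift]
    exact mul_mem ih shift_one_mem_realized

theorem conjTwist_mem_realized (a : Fin 5) : conjTwist a ∈ realized :=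
  mul_mem (mul_mem (shift_mem_realized _) twist_mem_realized) (shift_mem_realized _)

theorem twistProd_mem_realized (w : Fin 16) : twistProd w ∈ realized := by
  have h (p : Bool) (a : Fin 5) : (if p then conjTwist a else 1) ∈ realized := by
    split
    · exact conjTwist_mem_realized a
    · exact one_mem _
  exact mul_mem (mul_mem (mul_mem (h _ _) (h _ _)) (h _ _)) (h _ _)

theorem conjTwist_mul_self (c : Fin 5) :
    conjTwist (c + 1) * conjTwist (c + 1) = blockSign (fun b => if b = c then 0 else 1) := by
  have h : ∀ c : Fin 5, ∀ i,
      (conjTwist (c + 1) * conjTwist (c + 1)).phase i =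
          (blockSign (fun b => if b = c then 0 else 1)).phase i ∧
        (conjTwist (c + 1) * conjTwist (c + 1)).perm i = i := by
    decide +kernel
  exact MonomialData.ext (funext fun i => (h c i).1) (funext fun i => (h c i).2)

/-- The squares of the conjugates of `h₂` generate the blockwise signs of product one. -/
theorem blockSign_mem_realized {s : Fin 5 → ZMod 2} (hs : ∑ b, s b = 0) :
    blockSign s ∈ realized := by
  let A : AddSubmonoid (Fin 5 → ZMod 2) :=
    { carrier := {s | blockSign s ∈ realized}
      zero_mem' := one_mem realized
      add_mem' := fun {s t} hs ht => by
        change blockSign (s + t) ∈ realized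
        rw [← blockSign_mul_blockSign]
        exact mul_mem hs ht }
  have hA (c : Fin 5) : (fun b => if b = c then 0 else s c : Fin 5 → ZMod 2) ∈ A := by
    rcases (by decide : ∀ x : ZMod 2, x = 0 ∨ x = 1) (s c) with h | h
    · simp only [h, ite_self]
      exact A.zero_mem
    · rw [h]
      change blockSign _ ∈ realized
      rw [← conjTwist_mul_self]
      exact mul_mem (conjTwist_mem_realized _) (conjTwist_mem_realized _)
  have hsum : s = ∑ c, (fun b => if b = c then 0 else s c : Fin 5 → ZMod 2) := by
    funext b
    have h (c : Fin 5) : (if b = c then 0 else s c) = s c + if b = c then s c else 0 := by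
      split <;> simp [CharTwo.add_self_eq_zero]
    simp [Finset.sum_apply, h, Finset.sum_add_distrib, hs]
  change s ∈ A
  rw [hsum]
  exact sum_mem fun c _ => hA c

theorem normalForm_mem_realized (a : Fin 5) (w : Fin 16) {s : Fin 5 → ZMod 2}
    (hs : ∑ b, s b = 0) : normalForm a w s ∈ realized :=
  mul_mem (shift_mem_realized a) (mul_mem (twistProd_mem_realized w) (blockSign_mem_realized hs))

theorem isOfFinOrder_of_toEnd {g : (Fin 20 → ℂ) ≃ₗ[ℂ] (Fin 20 → ℂ)} {m : MonomialData}
    (h : (g : (Fin 20 → ℂ) →ₗ[ℂ] (Fin 20 → ℂ)) = toEnd m) {n : ℕ} (hn : 0 < n)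
    (hm : m ^ n = 1) : IsOfFinOrder g := by
  refine isOfFinOrder_iff_pow_eq_one.2 ⟨n, hn, LinearEquiv.toLinearMap_injective ?_⟩
  calc ((g ^ n : (Fin 20 → ℂ) ≃ₗ[ℂ] (Fin 20 → ℂ)) : (Fin 20 → ℂ) →ₗ[ℂ] (Fin 20 → ℂ))
      = (g : Module.End ℂ (Fin 20 → ℂ)) ^ n :=
        map_pow (LinearEquiv.automorphismGroup.toLinearMapMonoidHom (R := ℂ)) g n
    _ = 1 := by rw [h, ← map_pow, hm, map_one]

theorem exists_normalForm {g : (Fin 20 → ℂ) ≃ₗ[ℂ] (Fin 20 → ℂ)} (hg : g ∈ G1280) :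
    ∃ x : Fin 5 × Fin 16 × EvenSign,
      (g : (Fin 20 → ℂ) →ₗ[ℂ] (Fin 20 → ℂ)) = toEnd (normalForm x.1 x.2.1 x.2.2) := by
  let P (g : (Fin 20 → ℂ) ≃ₗ[ℂ] (Fin 20 → ℂ)) : Prop := ∃ x : Fin 5 × Fin 16 × EvenSign,
      (g : (Fin 20 → ℂ) →ₗ[ℂ] (Fin 20 → ℂ)) = toEnd (normalForm x.1 x.2.1 x.2.2)
  have h₁ (g) (hg : P g) : P (gen20₁ * g) := by
    obtain ⟨⟨a, w, s⟩, h⟩ := hg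
    refine ⟨⟨1 + a, w, s⟩, ?_⟩
    rw [← shift_mul_normalForm, map_mul, ← gen20₁_eq_toEnd, ← h]
    rfl
  have h₂ (g) (hg : P g) : P (gen20₂ * g) := by
    obtain ⟨⟨a, w, s⟩, h⟩ := hg
    refine ⟨⟨a, twistMask a ^^^ w, cocycle a w + s, ?_⟩, ?_⟩
    · simp [Finset.sum_add_distrib, sum_cocycle, s.2]
    · rw [← twist_mul_normalForm, map_mul, ← gen20₂_eq_toEnd, ← h]
      rfl
  have hfin (h : (Fin 20 → ℂ) ≃ₗ[ℂ] (Fin 20 → ℂ))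
      (hh : h ∈ ({gen20₁, gen20₂} : Set ((Fin 20 → ℂ) ≃ₗ[ℂ] (Fin 20 → ℂ)))) :
      IsOfFinOrder h := by
    rcases hh with rfl | rfl
    · refine isOfFinOrder_of_toEnd gen20₁_eq_toEnd (n := 5) (by norm_num) ?_
      simp only [pow_succ, pow_zero, one_mul, shift_mul_shift]
      exact shift_zero
    · refine isOfFinOrder_of_toEnd gen20₂_eq_toEnd (n := 4) (by norm_num) ?_
      ext i <;> revert i <;> decide +kernel
  rw [G1280, ← Subgroup.mem_toSubmonoid, Subgroup.closure_toSubmonoid_of_isOfFinOrder hfin] at hg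
  change P g
  induction hg using Submonoid.closure_induction_left with
  | one =>
    refine ⟨⟨0, 0, 0, by simp⟩, ?_⟩
    have : normalForm 0 0 0 = 1 := by ext i <;> revert i <;> decide +kernel
    exact (map_one toEnd).symm.trans (congrArg toEnd this.symm)
  | mul_left h hh g _ ih =>
    rcases hh with rfl | rfl
    · exact h₁ g ih
    · exact h₂ g ih

/-- The enumeration of `G` by normal forms. -/
def normalFormEquiv : Fin 5 × Fin 16 × EvenSign ≃ G1280 :=
  Equiv.ofBijective
    (fun x => ⟨(normalForm_mem_realized x.1 x.2.1 x.2.2.2).choose,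
      (normalForm_mem_realized x.1 x.2.1 x.2.2.2).choose_spec.1⟩) (by
    have hspec (x : Fin 5 × Fin 16 × EvenSign) :=
      (normalForm_mem_realized x.1 x.2.1 x.2.2.2).choose_spec.2
    constructor
    · intro x y hxy
      have h := congrArg (fun g : G1280 => (g.1 : (Fin 20 → ℂ) →ₗ[ℂ] (Fin 20 → ℂ))) hxy
      rw [hspec x, hspec y] at h
      obtain ⟨ha, hw, hs⟩ := normalForm_injective (toEnd_injective h)
      exact Prod.ext ha (Prod.ext hw (Subtype.ext hs))
    · rintro ⟨g, hg⟩
      obtain ⟨x, hx⟩ := exists_normalForm hg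
      exact ⟨x, Subtype.ext (LinearEquiv.toLinearMap_injective ((hspec x).trans hx.symm))⟩)

theorem tautRep_normalFormEquiv (x : Fin 5 × Fin 16 × EvenSign) :
    tautRep G1280 (normalFormEquiv x) = toEnd (normalForm x.1 x.2.1 x.2.2) :=
  (normalForm_mem_realized x.1 x.2.1 x.2.2.2).choose_spec.2

theorem card_G1280 : Nat.card G1280 = 1280 := by
  rw [← Nat.card_congr normalFormEquiv, Nat.card_eq_fintype_card]
  simp only [Fintype.card_prod, Fintype.card_fin, card_evenSign]

theorem FSindicator_tautRep_G1280 : FSindicator (tautRep G1280) = -1 := by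
  have hsum : ∑ᶠ g : G1280, repChar (tautRep G1280) (g * g) = -1280 := by
    rw [← finsum_comp_equiv normalFormEquiv, finsum_eq_sum_of_fintype, ← sum_trace_normalForm_sq]
    refine Finset.sum_congr rfl fun x _ => ?_
    rw [repChar, map_mul (tautRep G1280), tautRep_normalFormEquiv, map_mul toEnd]
  rw [FSindicator, hsum, card_G1280]
  norm_num

theorem hasEigenvalue_one_of_G1280 (g : G1280) :
    Module.End.HasEigenvalue (tautRep G1280 g) 1 := by
  obtain ⟨x, rfl⟩ := normalFormEquiv.surjective g
  rw [tautRep_normalFormEquiv]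
  exact normalForm_hasEigenvalue_one _ _ x.2.2.2

theorem omega20_apply (v w : Fin 20 → ℂ) : omega20 v w = ∑ j : Fin 10,
    (v ⟨2 * j.1, by omega⟩ * w ⟨2 * j.1 + 1, by omega⟩
      - v ⟨2 * j.1 + 1, by omega⟩ * w ⟨2 * j.1, by omega⟩) := rfl

theorem omega20_self (v : Fin 20 → ℂ) : omega20 v v = 0 := by
  rw [omega20_apply]
  exact Finset.sum_eq_zero fun j _ => by ring

theorem omega20_nondegenerate (v : Fin 20 → ℂ) (h : ∀ w, omega20 v w = 0) : v = 0 := by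
  have heven (j : Fin 10) : v ⟨2 * j.1, by omega⟩ = 0 := by
    have := h (Pi.single ⟨2 * j.1 + 1, by omega⟩ 1)
    rw [omega20_apply, Finset.sum_eq_single j] at this
    · simpa [Pi.single_apply] using this
    · intro k _ hk
      simp [Pi.single_apply, Fin.val_inj, hk]
      omega
    · simp
  have hodd (j : Fin 10) : v ⟨2 * j.1 + 1, by omega⟩ = 0 := by
    have := h (Pi.single ⟨2 * j.1, by omega⟩ 1)
    rw [omega20_apply, Finset.sum_eq_single j] at this
    · simpa [Pi.single_apply] using this
    · intro k _ hk
      simp [Pi.single_apply, Fin.val_inj, hk]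
      omega
    · simp
  funext i
  rcases Nat.even_or_odd' i.1 with ⟨k, hk | hk⟩
  · simpa [← hk] using heven ⟨k, by omega⟩
  · simpa [← hk] using hodd ⟨k, by omega⟩

theorem omega20_toEnd_shift (v w : Fin 20 → ℂ) :
    omega20 (toEnd (shift 1) v) (toEnd (shift 1) w) = omega20 v w := by
  simp only [omega20_apply, toEnd_apply]
  refine Fintype.sum_equiv (Equiv.addRight 2) _ _ fun j => ?_
  have h₀ : (shift 1).perm ⟨2 * j.1, by omega⟩ = ⟨2 * (j + 2 : Fin 10).1, by omega⟩ := by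
    revert j; decide
  have h₁ : (shift 1).perm ⟨2 * j.1 + 1, by omega⟩ = ⟨2 * (j + 2 : Fin 10).1 + 1, by omega⟩ := by
    revert j; decide
  rw [h₀, h₁]
  simp [shift]

theorem omega20_toEnd_twist (v w : Fin 20 → ℂ) :
    omega20 (toEnd twist v) (toEnd twist w) = omega20 v w := by
  simp [omega20_apply, toEnd_apply, Fin.sum_univ_succ, twist, pow_succ]
  ring_nf
  simp only [Complex.I_sq]
  ring

theorem omega20_tautRep (g : G1280) (v w : Fin 20 → ℂ) :
    omega20 (tautRep G1280 g v) (tautRep G1280 g w) = omega20 v w := by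
  obtain ⟨g, hg⟩ := g
  change omega20 (g v) (g w) = omega20 v w
  induction hg using Subgroup.closure_induction generalizing v w with
  | mem g hg =>
    rcases hg with rfl | rfl
    · have := omega20_toEnd_shift v w
      rwa [← gen20₁_eq_toEnd] at this
    · have := omega20_toEnd_twist v w
      rwa [← gen20₂_eq_toEnd] at this
  | one => rfl
  | mul g h _ _ ihg ihh => exact (ihg (h v) (h w)).trans (ihh v w)
  | inv g _ ih =>
    have h (u : Fin 20 → ℂ) : g (g⁻¹ u) = u := g.apply_symm_apply u
    rw [← ih, h, h]

theorem toEnd_mem_of_repInvariant {p : Submodule ℂ (Fin 20 → ℂ)}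
    (hp : RepInvariant (tautRep G1280) p) {m : MonomialData} (hm : m ∈ realized)
    {v : Fin 20 → ℂ} (hv : v ∈ p) : toEnd m v ∈ p := by
  obtain ⟨g, hg, hgm⟩ := hm
  rw [← hgm]
  exact hp ⟨g, hg⟩ v hv

/-- An invariant subspace containing a vector with nonzero first coordinate contains the first
basis vector: the blockwise signs isolate the first block, on which two of the monomial maps are
diagonal with distinct pairs of eigenvalues. -/
theorem single_zero_mem {p : Submodule ℂ (Fin 20 → ℂ)} (hp : RepInvariant (tautRep G1280) p)
    {v : Fin 20 → ℂ} (hv : v ∈ p) (hv0 : v 0 ≠ 0) : (Pi.single 0 1 : Fin 20 → ℂ) ∈ p := by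
  have step {m : MonomialData} (hm : m ∈ realized) (c : ℂ) {u : Fin 20 → ℂ} (hu : u ∈ p) :
      u + c • toEnd m u ∈ p :=
    add_mem hu (p.smul_mem c (toEnd_mem_of_repInvariant hp hm hu))
  have h₁ := step (m := blockSign ![0, 1, 1, 0, 0]) (blockSign_mem_realized (by decide)) 1 hv
  have h₂ := step (m := blockSign ![0, 0, 0, 1, 1]) (blockSign_mem_realized (by decide)) 1 h₁
  obtain ⟨u, hu, hup⟩ : ∃ u : Fin 20 → ℂ,
      (∀ i, u i = if block i = 0 then 4 * v i else 0) ∧ u ∈ p := by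
    refine ⟨_, fun i => ?_, h₂⟩
    have hi : ∀ b : Fin 5, b = 0 ∨ b = 1 ∨ b = 2 ∨ b = 3 ∨ b = 4 := by decide
    simp only [Pi.add_apply, Pi.smul_apply, toEnd_apply, blockSign]
    rcases hi (block i) with h | h | h | h | h <;> simp [h, signPhase]
    ring
  have hdiag {w : Fin 16} (hw : ∀ i, block i = 0 → (twistProd w).perm i = i)
      {u : Fin 20 → ℂ} (hu : ∀ i, block i ≠ 0 → u i = 0) (i : Fin 20) :
      toEnd (twistProd w) u i = Complex.I ^ ((twistProd w).phase i).val * u i := by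
    by_cases hi : block i = 0
    · rw [toEnd_apply, hw i hi]
    · rw [toEnd_apply, hu i hi, hu _ (by rwa [block_twistProd_perm])]
  have hu₀ (i : Fin 20) (hi : block i ≠ 0) : u i = 0 := by rw [hu, if_neg hi]
  have hd₁ := hdiag (w := 1) (by decide +kernel) hu₀
  have h₃ := step (twistProd_mem_realized 1) Complex.I hup
  have hd₆ := hdiag (w := 6) (by decide +kernel)
    (u := u + Complex.I • toEnd (twistProd 1) u) fun i hi => by simp [hd₁, hu₀ i hi]
  have h₄ := step (twistProd_mem_realized 6) (-1) h₃
  have heq : u + Complex.I • toEnd (twistProd 1) u +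
      (-1 : ℂ) • toEnd (twistProd 6) (u + Complex.I • toEnd (twistProd 1) u) =
      (16 * v 0) • (Pi.single 0 1 : Fin 20 → ℂ) := by
    funext i
    rw [Pi.add_apply, Pi.smul_apply, hd₆, Pi.add_apply, Pi.smul_apply, hd₁]
    by_cases hi : block i = 0
    · have hphase : ∀ i, block i = 0 →
          i = 0 ∧ (twistProd 1).phase i = 3 ∧ (twistProd 6).phase i = 2 ∨
          i ≠ 0 ∧ (twistProd 1).phase i = 1 ∨ i ≠ 0 ∧ (twistProd 6).phase i = 0 := by
        decide +kernel
      rw [hu, if_pos hi]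
      rcases hphase i hi with ⟨rfl, h₁, h₆⟩ | ⟨h, h₁⟩ | ⟨h, h₆⟩
      · rw [h₁, h₆]
        simp [Complex.I_pow_three, ← mul_assoc]
        ring
      · rw [h₁]
        simp [h, ← mul_assoc]
      · rw [h₆]
        simp [h]
    · have h : i ≠ 0 := by rintro rfl; exact hi rfl
      simp [hu₀ i hi, h]
  rw [heq] at h₄
  exact (p.smul_mem_iff (mul_ne_zero (by norm_num) hv0)).1 h₄

theorem repIrreducible_tautRep_G1280 : RepIrreducible (tautRep G1280) := by
  refine ⟨inferInstance, fun p hp => or_iff_not_imp_left.2 fun hne => ?_⟩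
  obtain ⟨v, hv, hv0⟩ := p.ne_bot_iff.1 hne
  obtain ⟨i, hi⟩ := Function.ne_iff.1 hv0
  have hreal (a : Fin 5) (w : Fin 16) : shift a * twistProd w ∈ realized :=
    mul_mem (shift_mem_realized a) (twistProd_mem_realized w)
  have hsingle : (Pi.single 0 1 : Fin 20 → ℂ) ∈ p := by
    have htrans : ∀ i, ∃ a w, (shift a * twistProd w).perm 0 = i := by decide +kernel
    obtain ⟨a, w, haw⟩ := htrans i
    refine single_zero_mem hp (toEnd_mem_of_repInvariant hp (hreal a w) hv) ?_
    rw [toEnd_apply, haw]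
    exact mul_ne_zero (pow_ne_zero _ Complex.I_ne_zero) hi
  rw [eq_top_iff, ← (Pi.basisFun ℂ (Fin 20)).span_eq, Submodule.span_le]
  rintro _ ⟨j, rfl⟩
  have htrans : ∀ j, ∃ a w, ∀ i, (shift a * twistProd w).perm i = 0 ↔ i = j := by decide +kernel
  obtain ⟨a, w, haw⟩ := htrans j
  have hmem := toEnd_mem_of_repInvariant hp (hreal a w) hsingle
  have heq : toEnd (shift a * twistProd w) (Pi.single 0 1) =
      Complex.I ^ ((shift a * twistProd w).phase j).val • Pi.basisFun ℂ (Fin 20) j := by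
    funext i
    rw [toEnd_apply]
    by_cases hij : i = j
    · rw [(haw i).2 hij]; simp [hij]
    · have := mt (haw i).1 hij
      simp [this, hij]
  rw [heq] at hmem
  exact (p.smul_mem_iff (pow_ne_zero _ Complex.I_ne_zero)).1 hmem

/-- Let `h₁, h₂ ∈ GL₂₀(ℂ)` be as above. Then the subgroup `G = ⟨h₁, h₂⟩`
of `GL₂₀(ℂ)` is finite of order `1280`, its tautological 20-dimensional representation on
`ℂ²⁰` is irreducible, every element of `G` has `1` as an eigenvalue, and every element of
`G` preserves the nondegenerate alternating bilinear form
`ω = ∑_{j=1}^{10} e*_{2j−1} ∧ e*_{2j}` (so the representation is of quaternionic type,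
i.e. has Frobenius–Schur indicator `−1`). -/
theorem statement13 :
    Finite G1280 ∧ Nat.card G1280 = 1280 ∧
    RepIrreducible (tautRep G1280) ∧
    (∀ g : G1280, Module.End.HasEigenvalue (tautRep G1280 g) 1) ∧
    (∀ v : Fin 20 → ℂ, omega20 v v = 0) ∧
    (∀ v : Fin 20 → ℂ, (∀ w : Fin 20 → ℂ, omega20 v w = 0) → v = 0) ∧
    (∀ g : G1280, ∀ v w : Fin 20 → ℂ,
      omega20 (tautRep G1280 g v) (tautRep G1280 g w) = omega20 v w) ∧
    FSindicator (tautRep G1280) = -1 := by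
  exact ⟨Nat.finite_of_card_ne_zero (by rw [card_G1280]; norm_num), card_G1280,
    repIrreducible_tautRep_G1280, hasEigenvalue_one_of_G1280, omega20_self,
    omega20_nondegenerate, omega20_tautRep, FSindicator_tautRep_G1280⟩

end
end
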